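/- arXiv:1106.5176 — 2 statements merged into one kernel-verified Lean document; each statement's English description precedes it below -/
import Mathlib

section
/- Let R₂ = 𝔽₂[X,Y]/(Y² + X·Y + X⁵ + X³ + X² + X), and write x, y for the images of X, Y in R₂. Then the class of the ideal (x, y) in ClassGroup(R₂) has order exactly 2, and the subgroup of ClassGroup(R₂) it generates has index 5. -/
noncomputable section

open Polynomial

/-- The polynomial `Y² + X·Y + (X⁵ + X³ + X² + X)` as an element of `𝔽₂[X][Y]`
(the outer variable is `Y`, the inner variable is `X`). -/
def f2 : Polynomial (Polynomial (ZMod 2)) :=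
  X ^ 2 + C X * X + C (X ^ 5 + X ^ 3 + X ^ 2 + X)

/-- The ring `R₂ = 𝔽₂[X,Y]/(Y² + X·Y + X⁵ + X³ + X² + X)`. -/
def R2 : Type := Polynomial (Polynomial (ZMod 2)) ⧸ Ideal.span {f2}

instance : CommRing R2 := Ideal.Quotient.commRing _

/-- The quotient map `𝔽₂[X][Y] → R₂`. -/
def toR2 : Polynomial (Polynomial (ZMod 2)) →+* R2 :=
  Ideal.Quotient.mk (Ideal.span {f2})

/-- The image `x` of `X` in `R₂`. -/
def x2 : R2 := toR2 (C X)

/-- The image `y` of `Y` in `R₂`. -/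
def y2 : R2 := toR2 X

open scoped nonZeroDivisors

/-- The inclusion of the coordinate ring `𝔽₂[X]` of the line into `R₂`. -/
def baseR2 : (ZMod 2)[X] →+* R2 := toR2.comp C

/-- The right-hand side `X⁵ + X³ + X² + X` of the curve equation. -/
def curvePoly : (ZMod 2)[X] := X ^ 5 + X ^ 3 + X ^ 2 + X

/-- The norm from `R₂` to `𝔽₂[X]` of the element `u + v y`. -/
def normForm (u v : (ZMod 2)[X]) : (ZMod 2)[X] := u ^ 2 - u * v * X + v ^ 2 * curvePoly

theorem f2_eq : f2 = X ^ 2 + (C X * X + C curvePoly) := by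
  simp only [f2, curvePoly, add_assoc]

theorem degree_f2_aux : (C X * X + C curvePoly : (ZMod 2)[X][X]).degree < (2 : ℕ) :=
  lt_of_le_of_lt (degree_linear_le) (by norm_num)

theorem f2_monic : f2.Monic := by
  rw [f2_eq]
  exact monic_X_pow_add degree_f2_aux

theorem degree_f2 : f2.degree = 2 := by
  rw [f2_eq, degree_add_eq_left_of_degree_lt, degree_X_pow]
  · rfl
  · rw [degree_X_pow]; exact degree_f2_aux

theorem toR2_surjective : Function.Surjective toR2 := Ideal.Quotient.mk_surjective

theorem toR2_eq_zero_iff (p : (ZMod 2)[X][X]) : toR2 p = 0 ↔ f2 ∣ p :=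
  Ideal.Quotient.eq_zero_iff_dvd f2 p

theorem two_eq_zero : (2 : R2) = 0 := by
  have h : (2 : (ZMod 2)[X]) = 0 := CharTwo.two_eq_zero
  rw [← map_ofNat baseR2 2, h, map_zero]

theorem x2_eq : x2 = baseR2 X := rfl

theorem curve_equation : y2 ^ 2 + x2 * y2 + (x2 ^ 5 + x2 ^ 3 + x2 ^ 2 + x2) = 0 := by
  have h := (toR2_eq_zero_iff f2).2 dvd_rfl
  simpa [f2, x2, y2] using h

theorem y2_sq : y2 ^ 2 = -(baseR2 X * y2) - baseR2 curvePoly := by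
  have h := curve_equation
  rw [x2_eq] at h
  simp only [curvePoly, map_add, map_pow]
  linear_combination h

theorem exists_repr (z : R2) : ∃ u v : (ZMod 2)[X], z = baseR2 u + baseR2 v * y2 := by
  obtain ⟨p, rfl⟩ := toR2_surjective z
  have hd : (p %ₘ f2).degree ≤ 1 := by
    have := degree_modByMonic_lt p f2_monic
    rw [degree_f2] at this
    exact Order.le_of_lt_succ this
  refine ⟨(p %ₘ f2).coeff 0, (p %ₘ f2).coeff 1, ?_⟩
  have h0 : toR2 (f2 * (p /ₘ f2)) = 0 := (toR2_eq_zero_iff _).2 (dvd_mul_right _ _)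
  conv_lhs => rw [← modByMonic_add_div p f2, map_add, h0, add_zero,
    eq_X_add_C_of_degree_le_one hd]
  simp [baseR2, y2, add_comm]

theorem repr_eq_zero {u v : (ZMod 2)[X]} (h : baseR2 u + baseR2 v * y2 = 0) : u = 0 ∧ v = 0 := by
  have h1 : toR2 (C v * X + C u) = 0 := by
    rw [← h]
    simp [baseR2, y2, add_comm]
  have h2 : (C v * X + C u : (ZMod 2)[X][X]) = 0 := by
    refine eq_zero_of_dvd_of_degree_lt ((toR2_eq_zero_iff _).1 h1) ?_
    rw [degree_f2]
    exact degree_linear_lt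
  constructor
  · simpa using congrArg (coeff · 0) h2
  · simpa using congrArg (coeff · 1) h2

theorem repr_unique {u v u' v' : (ZMod 2)[X]}
    (h : baseR2 u + baseR2 v * y2 = baseR2 u' + baseR2 v' * y2) : u = u' ∧ v = v' := by
  have h1 : baseR2 (u - u') + baseR2 (v - v') * y2 = 0 := by
    simp only [map_sub]
    linear_combination h
  obtain ⟨h2, h3⟩ := repr_eq_zero h1
  exact ⟨sub_eq_zero.1 h2, sub_eq_zero.1 h3⟩

theorem baseR2_injective : Function.Injective baseR2 := fun u u' h =>
  (repr_unique (v := 0) (v' := 0) (by simpa using h)).1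

theorem repr_mul (u v u' v' : (ZMod 2)[X]) :
    (baseR2 u + baseR2 v * y2) * (baseR2 u' + baseR2 v' * y2) =
      baseR2 (u * u' - v * v' * curvePoly) + baseR2 (u * v' + v * u' - v * v' * X) * y2 := by
  simp only [map_sub, map_add, map_mul]
  linear_combination (baseR2 v * baseR2 v') * y2_sq

theorem normForm_mul (u v u' v' : (ZMod 2)[X]) :
    normForm (u * u' - v * v' * curvePoly) (u * v' + v * u' - v * v' * X) =
      normForm u v * normForm u' v' := by
  simp only [normForm]
  ring

theorem normForm_conj (u v : (ZMod 2)[X]) : normForm (u - v * X) (-v) = normForm u v := by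
  simp only [normForm]
  ring

theorem repr_mul_conj (u v : (ZMod 2)[X]) :
    (baseR2 u + baseR2 v * y2) * (baseR2 (u - v * X) + baseR2 (-v) * y2) =
      baseR2 (normForm u v) := by
  rw [repr_mul, normForm,
    show u * -v + v * (u - v * X) - v * -v * X = 0 by ring, map_zero, zero_mul, add_zero]
  congr 1
  ring

theorem natDegree_curvePoly : curvePoly.natDegree = 5 := by
  unfold curvePoly
  compute_degree!

theorem curvePoly_ne_zero : curvePoly ≠ 0 := by
  intro h
  simpa [h] using natDegree_curvePoly

theorem normForm_of_ne_zero {u v : (ZMod 2)[X]} (hv : v ≠ 0) :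
    5 ≤ (normForm u v).natDegree := by
  have h1 : (v ^ 2 * curvePoly).natDegree = 2 * v.natDegree + 5 := by
    rw [natDegree_mul (pow_ne_zero _ hv) curvePoly_ne_zero, natDegree_pow, natDegree_curvePoly]
  have h2 : (u * v * X).natDegree ≤ u.natDegree + v.natDegree + 1 :=
    natDegree_mul_le.trans (add_le_add natDegree_mul_le natDegree_X_le)
  have h3 : (u ^ 2).natDegree = 2 * u.natDegree := natDegree_pow _ _
  rcases le_or_gt u.natDegree (v.natDegree + 2) with h | h
  · have h4 : (u ^ 2 - u * v * X).natDegree < (v ^ 2 * curvePoly).natDegree :=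
      (natDegree_sub_le _ _).trans_lt (by omega)
    rw [normForm, natDegree_add_eq_right_of_natDegree_lt h4]
    omega
  · have h4 : (-(u * v * X) + v ^ 2 * curvePoly).natDegree < (u ^ 2).natDegree := by
      refine (natDegree_add_le _ _).trans_lt ?_
      rw [natDegree_neg]
      omega
    rw [normForm, sub_eq_add_neg, add_assoc, natDegree_add_eq_left_of_natDegree_lt h4]
    omega

theorem normForm_eq_zero {u v : (ZMod 2)[X]} (h : normForm u v = 0) : u = 0 ∧ v = 0 := by
  have hv : v = 0 := by
    by_contra hv
    have := normForm_of_ne_zero (u := u) hv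
    simp [h] at this
  subst hv
  simpa [normForm] using h

theorem natDegree_normForm_lt {u v : (ZMod 2)[X]} {d : ℕ} (hu : u.natDegree < d)
    (hv : v = 0 ∨ v.natDegree + 3 ≤ d) : (normForm u v).natDegree < 2 * d := by
  have h3 : (u ^ 2).natDegree = 2 * u.natDegree := natDegree_pow _ _
  rcases hv with rfl | hv
  · simp only [normForm, mul_zero, zero_mul, sub_zero, add_zero, ne_eq, OfNat.ofNat_ne_zero,
      not_false_eq_true, zero_pow]
    omega
  · have h1 : (v ^ 2 * curvePoly).natDegree ≤ 2 * v.natDegree + 5 := by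
      refine natDegree_mul_le.trans ?_
      rw [natDegree_pow, natDegree_curvePoly]
    have h2 : (u * v * X).natDegree ≤ u.natDegree + v.natDegree + 1 :=
      natDegree_mul_le.trans (add_le_add natDegree_mul_le natDegree_X_le)
    have h4 := natDegree_sub_le (u ^ 2) (u * v * X)
    have h5 := natDegree_add_le (u ^ 2 - u * v * X) (v ^ 2 * curvePoly)
    rw [normForm]
    omega

/-- Among the polynomials of degree at most `2`, some nonzero one multiplies `v` into a
residue class modulo `n` of degree at most `deg n - 3`. -/
theorem exists_multiplier {n : (ZMod 2)[X]} (hn : n.Monic) (v : (ZMod 2)[X]) :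
    ∃ r : (ZMod 2)[X], r ∣ (X ^ 2 * (X + 1) ^ 2 * (X ^ 2 + X + 1)) ∧
      ((r * v) %ₘ n = 0 ∨ ((r * v) %ₘ n).natDegree + 3 ≤ n.natDegree) := by
  let s : (Fin 3 → ZMod 2) →ₗ[ZMod 2] (ZMod 2)[X] :=
    Fintype.linearCombination (ZMod 2) ![1, X, X ^ 2]
  let g : (Fin 3 → ZMod 2) →ₗ[ZMod 2] (ZMod 2)[X] :=
    (modByMonicHom n).comp ((LinearMap.mulRight (ZMod 2) v).comp s)
  let φ : (Fin 3 → ZMod 2) →ₗ[ZMod 2] (Fin 2 → ZMod 2) :=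
    LinearMap.pi ![(lcoeff (ZMod 2) (n.natDegree - 1)).comp g,
      (lcoeff (ZMod 2) (n.natDegree - 2)).comp g]
  obtain ⟨c, hc, hc0⟩ := (Submodule.ne_bot_iff _).1
    (LinearMap.ker_ne_bot_of_finrank_lt (f := φ) (by simp))
  have hc1 : ((s c * v) %ₘ n).coeff (n.natDegree - 1) = 0 := congrFun hc 0
  have hc2 : ((s c * v) %ₘ n).coeff (n.natDegree - 2) = 0 := congrFun hc 1
  refine ⟨s c, ?_, ?_⟩
  · have hs : s c = C (c 0) + C (c 1) * X + C (c 2) * X ^ 2 := by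
      simp [s, Fintype.linearCombination_apply, Fin.sum_univ_three, smul_eq_C_mul]
    have hz : ∀ a : ZMod 2, a = 0 ∨ a = 1 := by decide
    have h2 : (2 : (ZMod 2)[X]) = 0 := CharTwo.two_eq_zero
    rw [hs]
    rcases hz (c 0) with h0 | h0 <;> rcases hz (c 1) with h1 | h1 <;>
      rcases hz (c 2) with h2' | h2' <;>
      simp only [h0, h1, h2', map_zero, map_one, zero_add, zero_mul, add_zero, one_mul]
    · exact absurd (by ext i; fin_cases i <;> simp [h0, h1, h2']) hc0
    · exact ⟨(X + 1) ^ 2 * (X ^ 2 + X + 1), by ring⟩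
    · exact ⟨X * (X + 1) ^ 2 * (X ^ 2 + X + 1), by ring⟩
    · exact ⟨X * (X + 1) * (X ^ 2 + X + 1), by ring⟩
    · exact one_dvd _
    · exact ⟨X ^ 2 * (X ^ 2 + X + 1), by linear_combination X ^ 3 * (X ^ 2 + X + 1) * h2⟩
    · exact ⟨X ^ 2 * (X + 1) * (X ^ 2 + X + 1), by ring⟩
    · exact ⟨X ^ 2 * (X + 1) ^ 2, by ring⟩
  · by_contra! h
    obtain ⟨h0, h3⟩ := h
    have hlt := natDegree_lt_natDegree h0 (degree_modByMonic_lt (s c * v) hn)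
    have hl := leadingCoeff_ne_zero.2 h0
    rw [leadingCoeff] at hl
    obtain h | h : ((s c * v) %ₘ n).natDegree = n.natDegree - 1 ∨
        ((s c * v) %ₘ n).natDegree = n.natDegree - 2 := by omega
    · exact hl (h ▸ hc1)
    · exact hl (h ▸ hc2)

/-- A nonzero ideal contains a nonzero `b` such that a fixed polynomial multiplies the whole ideal
into `(b)`. -/
theorem exists_almost_generator {I : Ideal R2} (hI : I ≠ ⊥) :
    ∃ b ∈ I, b ≠ 0 ∧ ∀ a ∈ I, b ∣ baseR2 (X ^ 2 * (X + 1) ^ 2 * (X ^ 2 + X + 1)) * a := by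
  classical
  have hex : ∃ d : ℕ, ∃ u v : (ZMod 2)[X], baseR2 u + baseR2 v * y2 ∈ I ∧
      normForm u v ≠ 0 ∧ (normForm u v).natDegree = d := by
    obtain ⟨z, hz, hz0⟩ := (Submodule.ne_bot_iff _).1 hI
    obtain ⟨u, v, rfl⟩ := exists_repr z
    refine ⟨_, u, v, hz, fun h => hz0 ?_, rfl⟩
    obtain ⟨rfl, rfl⟩ := normForm_eq_zero h
    simp
  obtain ⟨u, v, hb, hn, hd⟩ := Nat.find_spec hex
  have hmin : ∀ e g : (ZMod 2)[X], baseR2 e + baseR2 g * y2 ∈ I → normForm e g ≠ 0 →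
      (normForm u v).natDegree ≤ (normForm e g).natDegree := fun e g h h0 =>
    hd ▸ Nat.find_min' hex ⟨e, g, h, h0, rfl⟩
  clear hd
  have hmonic : (normForm u v).Monic := by
    have h1 : ∀ a : ZMod 2, a ≠ 0 → a = 1 := by decide
    exact h1 _ (leadingCoeff_ne_zero.2 hn)
  refine ⟨_, hb, fun h => hn ?_, fun a ha => ?_⟩
  · obtain ⟨rfl, rfl⟩ := repr_eq_zero h
    simp [normForm]
  obtain ⟨u₁, v₁, rfl⟩ := exists_repr a
  set n := normForm u v with hn_def
  set U := u₁ * (u - v * X) - v₁ * -v * curvePoly with hU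
  set V := u₁ * -v + v₁ * (u - v * X) - v₁ * -v * X with hV
  obtain ⟨r, hr, hrV⟩ := exists_multiplier hmonic V
  suffices h : baseR2 u + baseR2 v * y2 ∣ baseR2 r * (baseR2 u₁ + baseR2 v₁ * y2) by
    refine h.trans (mul_dvd_mul_right ?_ _)
    exact map_dvd _ hr
  set s := (r * U) /ₘ n
  set t := (r * V) /ₘ n
  set U' := (r * U) %ₘ n with hU'
  set V' := (r * V) %ₘ n with hV'
  have hs : U' + n * s = r * U := modByMonic_add_div _ _
  have ht : V' + n * t = r * V := modByMonic_add_div _ _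
  refine ⟨baseR2 s + baseR2 t * y2, ?_⟩
  rw [← sub_eq_zero]
  obtain ⟨e, g, heg⟩ := exists_repr (baseR2 r * (baseR2 u₁ + baseR2 v₁ * y2) -
    (baseR2 u + baseR2 v * y2) * (baseR2 s + baseR2 t * y2))
  have hegI : baseR2 e + baseR2 g * y2 ∈ I := by
    rw [← heg]
    exact I.sub_mem (I.mul_mem_left _ ha) (I.mul_mem_right _ hb)
  have hprod : (baseR2 e + baseR2 g * y2) * (baseR2 (u - v * X) + baseR2 (-v) * y2) =
      baseR2 U' + baseR2 V' * y2 := by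
    have h1 := repr_mul u₁ v₁ (u - v * X) (-v)
    have h2 := repr_mul_conj u v
    rw [← hU, ← hV] at h1
    rw [← hn_def] at h2
    have h3 := congrArg baseR2 hs
    have h4 := congrArg baseR2 ht
    simp only [map_add, map_mul] at h3 h4
    rw [← heg]
    linear_combination baseR2 r * h1 - (baseR2 s + baseR2 t * y2) * h2 - h3 - y2 * h4
  rw [repr_mul] at hprod
  obtain ⟨hp1, hp2⟩ := repr_unique hprod
  have hnorm : normForm U' V' = normForm e g * n := by
    rw [← hp1, ← hp2, normForm_mul, normForm_conj]
  rw [heg]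
  by_contra hne
  have hN : normForm e g ≠ 0 := fun h => hne (by
    obtain ⟨rfl, rfl⟩ := normForm_eq_zero h
    simp)
  have hle := hmin e g hegI hN
  have hdeg : (normForm U' V').natDegree = (normForm e g).natDegree + n.natDegree := by
    rw [hnorm, natDegree_mul hN hn]
  have hUV : normForm U' V' ≠ 0 := hnorm ▸ mul_ne_zero hN hn
  rcases Nat.eq_zero_or_pos n.natDegree with h0 | h0
  · have hn1 : n = 1 := hmonic.natDegree_eq_zero.1 h0
    apply hUV
    rw [hU', hV', hn1, modByMonic_one, modByMonic_one]
    simp [normForm]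
  · have hlt : (normForm U' V').natDegree < 2 * n.natDegree := natDegree_normForm_lt (natDegree_modByMonic_lt (r * U) hmonic
      (fun h => by simp [h] at h0)) hrV
    omega

theorem exists_representative [IsDedekindDomain R2] (I : (Ideal R2)⁰) :
    ∃ J : (Ideal R2)⁰, baseR2 (X ^ 2 * (X + 1) ^ 2 * (X ^ 2 + X + 1)) ∈ (J : Ideal R2) ∧
      ClassGroup.mk0 J = ClassGroup.mk0 I := by
  obtain ⟨b, hbI, hb0, hb⟩ := exists_almost_generator (nonZeroDivisors.ne_zero I.2)
  set m := baseR2 (X ^ 2 * (X + 1) ^ 2 * (X ^ 2 + X + 1)) with hm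
  have hm0 : m ≠ 0 := by
    rw [hm, map_ne_zero_iff _ baseR2_injective]
    refine Monic.ne_zero ?_
    monicity!
  have hdvd : Ideal.span {b} ∣ Ideal.span {m} * (I : Ideal R2) := by
    rw [Ideal.dvd_iff_le, Ideal.span_singleton_mul_le_iff]
    intro z hz
    exact Ideal.mem_span_singleton.2 (hb z hz)
  obtain ⟨J, hJ⟩ := hdvd
  have hJ0 : J ≠ ⊥ := by
    rintro rfl
    have h : Ideal.span {m} * (I : Ideal R2) ≠ 0 :=
      mul_ne_zero (by simpa using hm0) (nonZeroDivisors.ne_zero I.2)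
    exact h (by rw [hJ, Ideal.mul_bot]; rfl)
  refine ⟨⟨J, mem_nonZeroDivisors_of_ne_zero hJ0⟩, ?_, ?_⟩
  · have h : m * b ∈ Ideal.span {b} * J := by
      rw [← hJ]
      exact Ideal.mul_mem_mul (Ideal.mem_span_singleton_self m) hbI
    obtain ⟨z, hz, hzb⟩ := Ideal.mem_span_singleton_mul.1 h
    rw [mul_comm m b] at hzb
    exact mul_left_cancel₀ hb0 hzb ▸ hz
  · exact ClassGroup.mk0_eq_mk0_iff.2 ⟨b, m, hb0, hm0, hJ.symm⟩

/-- An ideal `(h, y + w)` with `h` irreducible is maximal. -/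
theorem eq_of_span_le {h w : (ZMod 2)[X]} (hh : Irreducible h) {P : Ideal R2} (hP : P ≠ ⊤)
    (hle : Ideal.span {baseR2 h, y2 + baseR2 w} ≤ P) :
    Ideal.span {baseR2 h, y2 + baseR2 w} = P := by
  refine le_antisymm hle fun z hz => ?_
  obtain ⟨u, v, rfl⟩ := exists_repr z
  have hhP : baseR2 h ∈ P := hle (Ideal.subset_span (by simp))
  have hwP : y2 + baseR2 w ∈ P := hle (Ideal.subset_span (by simp))
  have he : baseR2 (u - v * w) ∈ P := by
    have : baseR2 (u - v * w) =
        (baseR2 u + baseR2 v * y2) - baseR2 v * (y2 + baseR2 w) := by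
      simp only [map_sub, map_mul]
      ring
    rw [this]
    exact P.sub_mem hz (P.mul_mem_left _ hwP)
  have hd : h ∣ u - v * w := by
    by_contra hd
    obtain ⟨α, β, hαβ⟩ := (hh.coprime_iff_not_dvd).2 hd
    refine hP ((Ideal.eq_top_iff_one _).2 ?_)
    rw [← map_one baseR2, ← hαβ, map_add, map_mul, map_mul]
    exact P.add_mem (P.mul_mem_left _ hhP) (P.mul_mem_left _ he)
  obtain ⟨k, hk⟩ := hd
  refine Ideal.mem_span_pair.2 ⟨baseR2 k, baseR2 v, ?_⟩
  have := congrArg baseR2 hk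
  simp only [map_sub, map_mul] at this
  linear_combination -this

theorem irreducible_quadratic : Irreducible (X ^ 2 + X + 1 : (ZMod 2)[X]) := by
  have hd : (X ^ 2 + X + 1 : (ZMod 2)[X]).natDegree = 2 := by compute_degree!
  refine irreducible_of_degree_le_three_of_not_isRoot ?_ ?_
  · simp [hd]
  · have : ∀ a : ZMod 2, a ^ 2 + a + 1 ≠ 0 := by decide
    intro a
    simpa using this a

theorem irreducible_X_add_one : Irreducible (X + 1 : (ZMod 2)[X]) :=
  irreducible_of_degree_eq_one (degree_X_add_C 1)

/-- The primes of `R₂` above `0`, `1` and the primitive cube roots of unity. -/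
theorem prime_cases {P : Ideal R2} [hP : P.IsPrime]
    (h : baseR2 (X ^ 2 * (X + 1) ^ 2 * (X ^ 2 + X + 1)) ∈ P) :
    Ideal.span {x2, y2} = P ∨ Ideal.span {x2 + 1, y2} = P ∨ Ideal.span {x2 + 1, y2 + 1} = P ∨
      Ideal.span {x2 ^ 2 + x2 + 1, y2 + 1} = P ∨
      Ideal.span {x2 ^ 2 + x2 + 1, y2 + x2 + 1} = P := by
  have hy := curve_equation
  have h2 := two_eq_zero
  simp only [map_mul, map_pow, map_add, map_one, ← x2_eq] at h
  have key : ∀ (s w : (ZMod 2)[X]), Irreducible s → baseR2 s ∈ P → y2 + baseR2 w ∈ P →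
      Ideal.span {baseR2 s, y2 + baseR2 w} = P := fun s w hs h1 h2 =>
    eq_of_span_le hs hP.ne_top (Ideal.span_le.2 (by
      rintro z (rfl | rfl)
      · exact h1
      · exact h2))
  rcases hP.mem_or_mem h with h | h
  · rcases hP.mem_or_mem h with h | h
    · have h := hP.mem_of_pow_mem _ h
      have hm : y2 ∈ P := by
        refine hP.mem_of_pow_mem 2 ?_
        rw [show y2 ^ 2 = (-(y2 + x2 ^ 4 + x2 ^ 2 + x2 + 1)) * x2 by linear_combination hy]
        exact P.mul_mem_left _ h
      have := key X 0 irreducible_X h (by simpa using hm)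
      simp only [map_zero, add_zero, ← x2_eq] at this
      exact .inl this
    · have h := hP.mem_of_pow_mem _ h
      have hm : y2 * (y2 + 1) ∈ P := by
        rw [show y2 * (y2 + 1) = (y2 + x2 ^ 4 + x2 ^ 3 + x2) * (x2 + 1) by
          grind]
        exact P.mul_mem_left _ h
      rcases hP.mem_or_mem hm with hm | hm
      · have := key (X + 1) 0 irreducible_X_add_one (by simpa [← x2_eq] using h) (by simpa using hm)
        simp only [map_add, map_one, map_zero, add_zero, ← x2_eq] at this
        exact .inr (.inl this)
      · have := key (X + 1) 1 irreducible_X_add_one (by simpa [← x2_eq] using h) (by simpa using hm)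
        simp only [map_add, map_one, ← x2_eq] at this
        exact .inr (.inr (.inl this))
  · have hm : (y2 + 1) * (y2 + x2 + 1) ∈ P := by
      rw [show (y2 + 1) * (y2 + x2 + 1) = (x2 + 1) ^ 3 * (x2 ^ 2 + x2 + 1) by
        grind]
      exact P.mul_mem_left _ h
    rcases hP.mem_or_mem hm with hm | hm
    · have := key (X ^ 2 + X + 1) 1 irreducible_quadratic (by simpa [← x2_eq] using h)
        (by simpa using hm)
      simp only [map_add, map_pow, map_one, ← x2_eq] at this
      exact .inr (.inr (.inr (.inl this)))
    · have := key (X ^ 2 + X + 1) (X + 1) irreducible_quadratic (by simpa [← x2_eq] using h)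
        (by simpa [← x2_eq, add_assoc] using hm)
      simp only [map_add, map_pow, map_one, ← x2_eq, ← add_assoc] at this
      exact .inr (.inr (.inr (.inr this)))

theorem dvd_of_baseR2_dvd {w a b : (ZMod 2)[X]} (h : baseR2 w ∣ baseR2 a + baseR2 b * y2) :
    w ∣ a ∧ w ∣ b := by
  obtain ⟨z, hz⟩ := h
  obtain ⟨u, v, rfl⟩ := exists_repr z
  have h1 : baseR2 a + baseR2 b * y2 = baseR2 (w * u) + baseR2 (w * v) * y2 := by
    rw [hz, map_mul, map_mul]
    ring
  obtain ⟨rfl, rfl⟩ := repr_unique h1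
  exact ⟨dvd_mul_right _ _, dvd_mul_right _ _⟩

/-- Divisors of a polynomial of degree at most `2` are themselves polynomials in `x`. -/
theorem exists_eq_baseR2_of_dvd {g : R2} {s : (ZMod 2)[X]} (hs : s ≠ 0) (hd : s.natDegree ≤ 2)
    (h : g ∣ baseR2 s) : ∃ w, g = baseR2 w := by
  obtain ⟨k, hk⟩ := h
  obtain ⟨u, v, rfl⟩ := exists_repr g
  obtain ⟨u', v', rfl⟩ := exists_repr k
  rw [repr_mul] at hk
  obtain ⟨h1, h2⟩ := repr_unique (u := s) (v := 0) (by rw [← hk, map_zero, zero_mul, add_zero])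
  have hN := normForm_mul u v u' v'
  rw [← h1, ← h2] at hN
  have hs2 : normForm s 0 = s ^ 2 := by simp [normForm]
  rw [hs2] at hN
  have hN0 : normForm u v * normForm u' v' ≠ 0 := hN ▸ pow_ne_zero 2 hs
  have hdeg := congrArg natDegree hN
  rw [natDegree_pow, natDegree_mul (left_ne_zero_of_mul hN0) (right_ne_zero_of_mul hN0)] at hdeg
  have hv : v = 0 := by
    by_contra hv
    have := normForm_of_ne_zero (u := u) hv
    omega
  exact ⟨u, by simp [hv]⟩

/-- Evaluation of `R₂` at the rational point `(a, 0)`. -/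
def evalPoint (a : ZMod 2) : R2 →+* ZMod 2 :=
  Ideal.Quotient.lift (Ideal.span {f2}) (eval₂RingHom (evalRingHom a) 0) (by
    have h : Ideal.span {f2} ≤ RingHom.ker (eval₂RingHom (evalRingHom a) 0) := by
      rw [Ideal.span_singleton_le_iff_mem, RingHom.mem_ker]
      have : ∀ a : ZMod 2, a ^ 5 + a ^ 3 + a ^ 2 + a = 0 := by decide
      simp only [f2, map_add, map_mul, map_pow, coe_eval₂RingHom, eval₂_X, eval₂_C, coe_evalRingHom,
        eval_X]
      simpa [-ZMod.pow_card] using this a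
    exact h)

theorem evalPoint_x2 (a : ZMod 2) : evalPoint a x2 = a :=
  (Ideal.Quotient.lift_mk _ _ _).trans (by simp)

theorem evalPoint_y2 (a : ZMod 2) : evalPoint a y2 = 0 :=
  (Ideal.Quotient.lift_mk _ _ _).trans (by simp)

theorem span_ne_top {s : R2} {a : ZMod 2} (h : evalPoint a s = 0) :
    Ideal.span {s, y2} ≠ ⊤ := by
  intro ht
  have hle : Ideal.span {s, y2} ≤ RingHom.ker (evalPoint a) := by
    rw [Ideal.span_le]
    rintro z (rfl | rfl)
    · exact h
    · exact evalPoint_y2 a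
  rw [ht, top_le_iff] at hle
  exact RingHom.ker_ne_top _ hle

theorem not_isPrincipal_origin : ¬ (Ideal.span {x2, y2}).IsPrincipal := by
  rintro ⟨g, hg⟩
  change _ = Ideal.span {g} at hg
  have hx : g ∣ x2 := Ideal.mem_span_singleton.1 (hg ▸ Ideal.subset_span (by simp))
  have hy : g ∣ y2 := Ideal.mem_span_singleton.1 (hg ▸ Ideal.subset_span (by simp))
  obtain ⟨w, rfl⟩ := exists_eq_baseR2_of_dvd X_ne_zero (by simp) hx
  have h1 := (dvd_of_baseR2_dvd (a := 0) (b := 1) (by simpa using hy)).2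
  refine span_ne_top (a := 0) (s := x2) (evalPoint_x2 0) ?_
  rw [hg, Ideal.span_singleton_eq_top]
  exact (isUnit_of_dvd_one h1).map baseR2

theorem not_isPrincipal_sq :
    ¬ (Ideal.span {x2 + 1, y2} * Ideal.span {x2 + 1, y2}).IsPrincipal := by
  rintro ⟨g, hg⟩
  change _ = Ideal.span {g} at hg
  have hmem : ∀ s ∈ ({x2 + 1, y2} : Set R2), ∀ t ∈ ({x2 + 1, y2} : Set R2), g ∣ s * t :=
    fun s hs t ht => Ideal.mem_span_singleton.1
      (hg ▸ Ideal.mul_mem_mul (Ideal.subset_span hs) (Ideal.subset_span ht))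
  have hxx := hmem (x2 + 1) (by simp) (x2 + 1) (by simp)
  have hxy := hmem (x2 + 1) (by simp) y2 (by simp)
  have hyy := hmem y2 (by simp) y2 (by simp)
  have hm : ((X + 1) * (X + 1) : (ZMod 2)[X]).Monic := (monic_X_add_C 1).mul (monic_X_add_C 1)
  obtain ⟨w, rfl⟩ := exists_eq_baseR2_of_dvd hm.ne_zero (by compute_degree)
    (by simpa [← x2_eq] using hxx)
  have h1 := (dvd_of_baseR2_dvd (a := 0) (b := X + 1) (by simpa [← x2_eq] using hxy)).2
  have h2 := (dvd_of_baseR2_dvd (a := -curvePoly) (b := -X) (by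
    rw [← pow_two, y2_sq] at hyy
    convert hyy using 1
    simp only [map_neg]
    ring)).2
  have h3 : w ∣ 1 := by simpa using dvd_add h1 h2
  refine span_ne_top (a := 1) (s := x2 + 1) (by rw [map_add, evalPoint_x2, map_one]; decide) ?_
  have hu : Ideal.span {x2 + 1, y2} * Ideal.span {x2 + 1, y2} = ⊤ := by
    rw [hg, Ideal.span_singleton_eq_top]
    exact (isUnit_of_dvd_one h3).map baseR2
  exact top_le_iff.1 (hu ▸ Ideal.mul_le_left)

theorem Ideal.span_pair_mul_span_pair_eq_span_pair {R : Type*} [CommRing R] {A B Z : R}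
    (α β γ δ : R) (h : Z = α * (A * B) + β * (A * Z) + γ * (B * Z) + δ * Z ^ 2) :
    Ideal.span {A, Z} * Ideal.span {B, Z} = Ideal.span {A * B, Z} := by
  rw [Ideal.span_pair_mul_span_pair]
  refine le_antisymm (Ideal.span_le.2 ?_) (Ideal.span_le.2 ?_)
  · rintro z (rfl | rfl | rfl | rfl)
    · exact Ideal.subset_span (by simp)
    · exact Ideal.mul_mem_left _ _ (Ideal.subset_span (by simp))
    · exact Ideal.mul_mem_right _ _ (Ideal.subset_span (by simp))
    · exact Ideal.mul_mem_left _ _ (Ideal.subset_span (by simp))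
  · rintro z (rfl | rfl)
    · exact Ideal.subset_span (by simp)
    · rw [SetLike.mem_coe]
      nth_rewrite 5 [h]
      refine add_mem (add_mem (add_mem ?_ ?_) ?_) ?_ <;>
        refine Ideal.mul_mem_left _ _ (Ideal.subset_span ?_) <;> simp [pow_two, mul_comm]

theorem Ideal.span_pair_mul_span_pair_eq_span_singleton {R : Type*} [CommRing R] {A Z Z' E : R}
    (hE : Z * Z' = A * E) (α β γ δ : R) (h : 1 = α * A + β * Z + γ * Z' + δ * E) :
    Ideal.span {A, Z} * Ideal.span {A, Z'} = Ideal.span {A} := by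
  rw [Ideal.span_pair_mul_span_pair]
  refine le_antisymm (Ideal.span_le.2 ?_) ((Ideal.span_singleton_le_iff_mem _).2 ?_)
  · rintro z (rfl | rfl | rfl | rfl) <;> rw [SetLike.mem_coe, Ideal.mem_span_singleton]
    · exact dvd_mul_right _ _
    · exact dvd_mul_right _ _
    · exact dvd_mul_left _ _
    · exact hE ▸ dvd_mul_right _ _
  · have hA : A = α * (A * A) + β * (Z * A) + γ * (A * Z') + δ * (Z * Z') := by
      rw [hE]
      linear_combination A * h
    rw [hA]
    refine add_mem (add_mem (add_mem ?_ ?_) ?_) ?_ <;>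
      refine Ideal.mul_mem_left _ _ (Ideal.subset_span ?_) <;> simp [← hA]

theorem Ideal.span_pair_eq_span_singleton {R : Type*} [CommRing R] {A Z : R} (h : Z ∣ A) :
    Ideal.span {A, Z} = Ideal.span {Z} := by
  rw [Ideal.span_insert, sup_eq_right, Ideal.span_singleton_le_span_singleton]
  exact h

theorem span_origin_sq : Ideal.span {x2, y2} * Ideal.span {x2, y2} = Ideal.span {x2} := by
  have hy := curve_equation
  have h2 := two_eq_zero
  refine Ideal.span_pair_mul_span_pair_eq_span_singleton
    (E := y2 + x2 ^ 4 + x2 ^ 2 + x2 + 1) ?_ (-(x2 ^ 3 + x2 + 1)) (-1) 0 1 ?_ <;> grind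

theorem span_mul_span_one :
    Ideal.span {x2 + 1, y2} * Ideal.span {x2 + 1, y2 + 1} = Ideal.span {x2 + 1} := by
  have hy := curve_equation
  have h2 := two_eq_zero
  refine Ideal.span_pair_mul_span_pair_eq_span_singleton
    (E := y2 + x2 ^ 4 + x2 ^ 3 + x2) ?_ 0 (-1) 1 0 ?_ <;> grind

theorem span_mul_span_quadratic :
    Ideal.span {x2 ^ 2 + x2 + 1, y2 + 1} * Ideal.span {x2 ^ 2 + x2 + 1, y2 + x2 + 1} =
      Ideal.span {x2 ^ 2 + x2 + 1} := by
  have hy := curve_equation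
  have h2 := two_eq_zero
  refine Ideal.span_pair_mul_span_pair_eq_span_singleton
    (E := (x2 + 1) ^ 3) ?_ 1 (x2 + 1) (-(x2 + 1)) 0 ?_ <;> grind

theorem span_relation_y_add_one :
    Ideal.span {x2 + 1, y2 + 1} * Ideal.span {x2 + 1, y2 + 1} * Ideal.span {x2 + 1, y2 + 1} *
      Ideal.span {x2 ^ 2 + x2 + 1, y2 + 1} = Ideal.span {y2 + 1} := by
  have hy := curve_equation
  have h2 := two_eq_zero
  rw [Ideal.span_pair_mul_span_pair_eq_span_pair ((x2 + 1) * (x2 ^ 2 + x2 + 1)) 0 1 1 (by grind),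
    Ideal.span_pair_mul_span_pair_eq_span_pair (x2 ^ 2 + x2 + 1) 0 1 1 (by grind),
    Ideal.span_pair_mul_span_pair_eq_span_pair (x2 + 1) 0 1 (x2 + 1) (by grind)]
  exact Ideal.span_pair_eq_span_singleton ⟨y2 + x2 + 1, by grind⟩

theorem span_pair_congr {A Z Z' : R2} (k : R2) (h : Z' = Z + k * A) :
    Ideal.span {A, Z} = Ideal.span {A, Z'} := by
  rw [h, Ideal.span_pair_add_mul_left]

theorem span_relation_y_add_sq :
    Ideal.span {x2 + 1, y2 + 1} * Ideal.span {x2 + 1, y2 + 1} * Ideal.span {x2, y2} *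
      Ideal.span {x2 ^ 2 + x2 + 1, y2 + x2 + 1} = Ideal.span {y2 + x2 ^ 2} := by
  have hy := curve_equation
  have h2 := two_eq_zero
  rw [span_pair_congr (A := x2 + 1) (Z' := y2 + x2 ^ 2) (x2 + 1) (by grind),
    span_pair_congr (A := x2) (Z' := y2 + x2 ^ 2) x2 (by grind),
    span_pair_congr (A := x2 ^ 2 + x2 + 1) (Z' := y2 + x2 ^ 2) 1 (by grind),
    Ideal.span_pair_mul_span_pair_eq_span_pair (x2 * (x2 ^ 2 + x2 + 1)) 0 1 1 (by grind),
    Ideal.span_pair_mul_span_pair_eq_span_pair 0 1 x2 0 (by grind),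
    Ideal.span_pair_mul_span_pair_eq_span_pair (x2 + 1) 0 1 (x2 + 1) (by grind)]
  exact Ideal.span_pair_eq_span_singleton ⟨y2 + x2 + x2 ^ 2, by grind⟩

theorem span_mem_nonZeroDivisors [IsDomain R2] {s : (ZMod 2)[X]} (hs : s ≠ 0) (z : R2) :
    Ideal.span {baseR2 s, z} ∈ (Ideal R2)⁰ := by
  refine mem_nonZeroDivisors_of_ne_zero fun h => hs ?_
  have h1 : baseR2 s ∈ Ideal.span {baseR2 s, z} := Ideal.subset_span (by simp)
  rw [h] at h1
  exact baseR2_injective (by simpa using h1)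

/-- A set of ideal classes containing those of all prime ideals that contain `m` generates
the classes of all ideals containing `m`. -/
theorem ClassGroup.mk0_mem_of_mem {R : Type*} [CommRing R] [IsDedekindDomain R] {m : R}
    (H : Subgroup (ClassGroup R))
    (hH : ∀ P : (Ideal R)⁰, (P : Ideal R).IsPrime → m ∈ (P : Ideal R) → ClassGroup.mk0 P ∈ H)
    (J : (Ideal R)⁰) (hJ : m ∈ (J : Ideal R)) : ClassGroup.mk0 J ∈ H := by
  obtain ⟨J, hJ0⟩ := J
  induction J using UniqueFactorizationMonoid.induction_on_prime with
  | h₁ => exact absurd rfl (nonZeroDivisors.ne_zero hJ0)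
  | h₂ J hu =>
    have hJ1 : (⟨J, hJ0⟩ : (Ideal R)⁰) = 1 := Subtype.ext (by simpa using Ideal.isUnit_iff.1 hu)
    rw [hJ1, map_one]
    exact H.one_mem
  | h₃ J P hJne hP ih =>
    have h1 : (⟨P * J, hJ0⟩ : (Ideal R)⁰) =
        ⟨P, mem_nonZeroDivisors_of_ne_zero hP.ne_zero⟩ *
          ⟨J, mem_nonZeroDivisors_of_ne_zero hJne⟩ := rfl
    rw [h1, map_mul]
    have hmul : m ∈ P * J := hJ
    have hmP : m ∈ P := Ideal.le_of_dvd (dvd_mul_right P J) hmul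
    have hmJ : m ∈ J := Ideal.le_of_dvd (dvd_mul_left J P) hmul
    exact H.mul_mem (hH ⟨P, _⟩ (Ideal.isPrime_of_prime hP) hmP) (ih _ hmJ)

theorem ClassGroup.mk0_eq_one_of_eq_span {R : Type*} [CommRing R] [IsDedekindDomain R]
    {J : (Ideal R)⁰} {z : R} (h : (J : Ideal R) = Ideal.span {z}) : ClassGroup.mk0 J = 1 :=
  (ClassGroup.mk0_eq_one_iff J.2).2 ⟨z, h⟩

/-- The class of the ideal `(x, y)` has order exactly 2 in the class group of `R₂`, and
the subgroup it generates has index 5.  (The hypotheses `IsDedekindDomain R2` and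
`hxy` are true facts, supplied so that the class `ClassGroup.mk0 ⟨_, hxy⟩` makes sense.) -/
theorem stmt_7 [IsDedekindDomain R2]
    (hxy : Ideal.span {x2, y2} ∈ (Ideal R2)⁰) :
    orderOf (ClassGroup.mk0 (⟨Ideal.span {x2, y2}, hxy⟩ : (Ideal R2)⁰)) = 2 ∧
    (Subgroup.zpowers
      (ClassGroup.mk0 (⟨Ideal.span {x2, y2}, hxy⟩ : (Ideal R2)⁰))).index = 5 := by
  let q : (Ideal R2)⁰ := ⟨Ideal.span {x2 + 1, y2}, by
    simpa [← x2_eq] using span_mem_nonZeroDivisors (X_add_C_ne_zero (1 : ZMod 2)) y2⟩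
  let q' : (Ideal R2)⁰ := ⟨Ideal.span {x2 + 1, y2 + 1}, by
    simpa [← x2_eq] using span_mem_nonZeroDivisors (X_add_C_ne_zero (1 : ZMod 2)) (y2 + 1)⟩
  let r : (Ideal R2)⁰ := ⟨Ideal.span {x2 ^ 2 + x2 + 1, y2 + 1}, by
    simpa [← x2_eq] using span_mem_nonZeroDivisors irreducible_quadratic.ne_zero (y2 + 1)⟩
  let r' : (Ideal R2)⁰ := ⟨Ideal.span {x2 ^ 2 + x2 + 1, y2 + x2 + 1}, by
    simpa [← x2_eq] using span_mem_nonZeroDivisors irreducible_quadratic.ne_zero (y2 + x2 + 1)⟩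
  set p : (Ideal R2)⁰ := ⟨Ideal.span {x2, y2}, hxy⟩
  have hpp : ClassGroup.mk0 p * ClassGroup.mk0 p = 1 := by
    rw [← map_mul]
    exact ClassGroup.mk0_eq_one_of_eq_span span_origin_sq
  have hqq : ClassGroup.mk0 q * ClassGroup.mk0 q' = 1 := by
    rw [← map_mul]
    exact ClassGroup.mk0_eq_one_of_eq_span span_mul_span_one
  have hrr : ClassGroup.mk0 r * ClassGroup.mk0 r' = 1 := by
    rw [← map_mul]
    exact ClassGroup.mk0_eq_one_of_eq_span span_mul_span_quadratic
  have hqr : ClassGroup.mk0 q' * ClassGroup.mk0 q' * ClassGroup.mk0 q' * ClassGroup.mk0 r = 1 := by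
    simp only [← map_mul]
    exact ClassGroup.mk0_eq_one_of_eq_span span_relation_y_add_one
  have hqp : ClassGroup.mk0 q' * ClassGroup.mk0 q' * ClassGroup.mk0 p * ClassGroup.mk0 r' = 1 := by
    simp only [← map_mul]
    exact ClassGroup.mk0_eq_one_of_eq_span span_relation_y_add_sq
  have hp1 : ClassGroup.mk0 p ≠ 1 := fun h =>
    not_isPrincipal_origin ((ClassGroup.mk0_eq_one_iff hxy).1 h)
  have hq1 : ClassGroup.mk0 q ^ 2 ≠ 1 := by
    rw [pow_two, ← map_mul]
    exact fun h => not_isPrincipal_sq ((ClassGroup.mk0_eq_one_iff (q * q).2).1 h)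
  have hq' : ClassGroup.mk0 q' = (ClassGroup.mk0 q)⁻¹ := eq_inv_of_mul_eq_one_right hqq
  have hr' : ClassGroup.mk0 r' = (ClassGroup.mk0 r)⁻¹ := eq_inv_of_mul_eq_one_right hrr
  have hr : ClassGroup.mk0 r = ClassGroup.mk0 q ^ 3 := by
    rw [eq_inv_of_mul_eq_one_right hqr, hq']
    group
  have hp : ClassGroup.mk0 p = ClassGroup.mk0 q ^ 5 := by
    rw [hr', hr, hq', mul_inv_eq_one] at hqp
    rw [← mul_right_inj ((ClassGroup.mk0 q)⁻¹ * (ClassGroup.mk0 q)⁻¹), hqp]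
    group
  have horder : orderOf (ClassGroup.mk0 q) = 10 := by
    refine orderOf_eq_of_pow_and_pow_div_prime (by norm_num) ?_ fun l hl hl10 => ?_
    · rw [show 10 = 5 + 5 from rfl, pow_add, ← hp, hpp]
    · have hl' : l = 2 ∨ l = 5 := by
        have h25 : l ∣ 2 * 5 := hl10
        exact (hl.dvd_mul.1 h25).imp (Nat.prime_dvd_prime_iff_eq hl Nat.prime_two).1
          (Nat.prime_dvd_prime_iff_eq hl Nat.prime_five).1
      rcases hl' with rfl | rfl
      · exact hp ▸ hp1
      · exact hq1
  have htop : Subgroup.zpowers (ClassGroup.mk0 q) = ⊤ := by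
    refine eq_top_iff.2 fun c _ => ?_
    obtain ⟨I, rfl⟩ := ClassGroup.mk0_surjective c
    obtain ⟨J, hJ, hJI⟩ := exists_representative I
    rw [← hJI]
    refine ClassGroup.mk0_mem_of_mem _ (fun P hP hm => ?_) J hJ
    have hmem := Subgroup.mem_zpowers (ClassGroup.mk0 q)
    rcases prime_cases hm with h | h | h | h | h
    · rw [← Subtype.ext (a1 := p) h, hp]
      exact pow_mem hmem 5
    · exact Subtype.ext (a1 := q) h ▸ hmem
    · rw [← Subtype.ext (a1 := q') h, hq']
      exact inv_mem hmem
    · rw [← Subtype.ext (a1 := r) h, hr]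
      exact pow_mem hmem 3
    · rw [← Subtype.ext (a1 := r') h, hr', hr]
      exact inv_mem (pow_mem hmem 3)
  have hp2 : orderOf (ClassGroup.mk0 p) = 2 := orderOf_eq_prime (by rw [pow_two, hpp]) hp1
  refine ⟨hp2, ?_⟩
  have hcard := (Subgroup.zpowers (ClassGroup.mk0 p)).index_mul_card
  rw [Nat.card_zpowers, hp2, ← Subgroup.card_top, ← htop, Nat.card_zpowers, horder] at hcard
  omega
end
end

section
/- Let R₅ = 𝔽₅[X,Y]/(Y² − X⁵ + X³ − X), and write x, y for the images of X, Y in R₅. Then the subgroup of ClassGroup(R₅) generated by the classes of the three maximal ideals (x, y), (x − 4, y − 3), and (x − 4, y − 2) has index 8 in ClassGroup(R₅). -/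
noncomputable section

open Polynomial

instance : Fact (Nat.Prime 5) := ⟨by norm_num⟩

/-- The polynomial `Y² − (X⁵ − X³ + X)` as an element of `𝔽₅[X][Y]`
(the outer variable is `Y`, the inner variable is `X`). -/
def f5 : Polynomial (Polynomial (ZMod 5)) :=
  X ^ 2 - C (X ^ 5 - X ^ 3 + X)

/-- The ring `R₅ = 𝔽₅[X,Y]/(Y² − X⁵ + X³ − X)`. -/
def R5 : Type := Polynomial (Polynomial (ZMod 5)) ⧸ Ideal.span {f5}

instance : CommRing R5 := Ideal.Quotient.commRing _

/-- The quotient map `𝔽₅[X][Y] → R₅`. -/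
def toR5 : Polynomial (Polynomial (ZMod 5)) →+* R5 :=
  Ideal.Quotient.mk (Ideal.span {f5})

/-- The image `x` of `X` in `R₅`. -/
def x5 : R5 := toR5 (C X)

/-- The image `y` of `Y` in `R₅`. -/
def y5 : R5 := toR5 X

open scoped nonZeroDivisors

/-- The polynomial `X⁵ − X³ + X`, whose image in `R₅` is `y²`. -/
def g5 : (ZMod 5)[X] := X ^ 5 - X ^ 3 + X

/-- The structure map `𝔽₅[X] → R₅`. -/
def incl : (ZMod 5)[X] →+* R5 := toR5.comp C

lemma incl_X : incl X = x5 := rfl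

lemma y5_mul_self : y5 * y5 = incl g5 := by
  have h : toR5 f5 = 0 := Ideal.Quotient.eq_zero_iff_mem.2 (Ideal.mem_span_singleton_self f5)
  rw [f5, map_sub, map_pow, pow_two] at h
  exact sub_eq_zero.1 h

lemma f5_monic : f5.Monic := monic_X_pow_sub_C _ two_ne_zero

lemma f5_natDegree : f5.natDegree = 2 := natDegree_X_pow_sub_C

lemma exists_eq_incl_add (z : R5) : ∃ a b, z = incl a + incl b * y5 := by
  obtain ⟨p, rfl⟩ := Ideal.Quotient.mk_surjective z
  have hd : (p %ₘ f5).natDegree ≤ 1 := by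
    have := natDegree_modByMonic_lt p f5_monic (fun h => by simpa [h] using f5_natDegree)
    rw [f5_natDegree] at this
    omega
  obtain ⟨b, a, h⟩ := exists_eq_X_add_C_of_natDegree_le_one hd
  refine ⟨a, b, ?_⟩
  have h1 : toR5 p = toR5 (p %ₘ f5) := by
    refine Ideal.Quotient.eq.2 (Ideal.mem_span_singleton.2 ⟨p /ₘ f5, ?_⟩)
    linear_combination -modByMonic_add_div p f5
  change toR5 p = _
  rw [h1, h, map_add, map_mul, add_comm]
  rfl

lemma incl_add_eq_zero {a b : (ZMod 5)[X]} (h : incl a + incl b * y5 = 0) : a = 0 ∧ b = 0 := by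
  have h1 : toR5 (C b * X + C a) = 0 := by
    rw [map_add, map_mul, add_comm]
    exact h
  have h2 : f5 ∣ C b * X + C a := Ideal.mem_span_singleton.1 (Ideal.Quotient.eq_zero_iff_mem.1 h1)
  have h3 : C b * X + C a = 0 := by
    refine eq_zero_of_dvd_of_natDegree_lt h2 ?_
    rw [f5_natDegree]
    exact lt_of_le_of_lt natDegree_linear_le one_lt_two
  constructor
  · simpa using congrArg (coeff · 0) h3
  · simpa using congrArg (coeff · 1) h3

lemma incl_add_inj {a b c d : (ZMod 5)[X]}
    (h : incl a + incl b * y5 = incl c + incl d * y5) : a = c ∧ b = d := by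
  have := incl_add_eq_zero (a := a - c) (b := b - d)
    (by rw [map_sub, map_sub]; linear_combination h)
  exact ⟨sub_eq_zero.1 this.1, sub_eq_zero.1 this.2⟩

lemma incl_injective : Function.Injective incl := fun a b h =>
  (incl_add_inj (b := 0) (d := 0) (by rw [h])).1

/-- The ideal `(u, y − v)` of `R₅` with Mumford coordinates `u` and `v`. -/
def mumford (u v : (ZMod 5)[X]) : Ideal R5 := Ideal.span {incl u, y5 - incl v}

lemma mem_mumford {u v : (ZMod 5)[X]} (h : u ∣ g5 - v ^ 2) (a b : (ZMod 5)[X]) :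
    incl a + incl b * y5 ∈ mumford u v ↔ u ∣ a + b * v := by
  rw [mumford, Ideal.mem_span_pair]
  constructor
  · rintro ⟨r, s, hrs⟩
    obtain ⟨r₀, r₁, rfl⟩ := exists_eq_incl_add r
    obtain ⟨s₀, s₁, rfl⟩ := exists_eq_incl_add s
    have key : incl (r₀ * u + s₁ * g5 - s₀ * v) + incl (r₁ * u + s₀ - s₁ * v) * y5
        = incl a + incl b * y5 := by
      rw [← hrs]
      simp only [map_add, map_sub, map_mul, ← y5_mul_self]
      ring
    obtain ⟨rfl, rfl⟩ := incl_add_inj key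
    have : r₀ * u + s₁ * g5 - s₀ * v + (r₁ * u + s₀ - s₁ * v) * v
        = u * (r₀ + r₁ * v) + (g5 - v ^ 2) * s₁ := by ring
    rw [this]
    exact dvd_add (dvd_mul_right _ _) (h.mul_right _)
  · rintro ⟨c, hc⟩
    refine ⟨incl c, incl b, ?_⟩
    have := congrArg incl hc
    simp only [map_add, map_mul] at this
    linear_combination -this

lemma incl_mem_mumford {u v : (ZMod 5)[X]} (h : u ∣ g5 - v ^ 2) (a : (ZMod 5)[X]) :
    incl a ∈ mumford u v ↔ u ∣ a := by
  simpa using mem_mumford h a 0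

lemma mumford_congr {u v u' v' : (ZMod 5)[X]} (hu : Associated u u') (hv : u ∣ v - v') :
    mumford u v = mumford u' v' := by
  have aux : ∀ {u v u' v' : (ZMod 5)[X]}, Associated u u' → u ∣ v - v' →
      mumford u v ≤ mumford u' v' := by
    intro u v u' v' hu hv
    rw [mumford, Ideal.span_le, Set.insert_subset_iff, Set.singleton_subset_iff]
    obtain ⟨c, rfl⟩ := hu.symm.dvd
    obtain ⟨d, hd⟩ := hv
    constructor
    · exact Ideal.mem_span_pair.2 ⟨incl c, 0, by rw [map_mul]; ring⟩
    · refine Ideal.mem_span_pair.2 ⟨-incl (c * d), 1, ?_⟩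
      have := congrArg incl hd
      simp only [map_sub, map_mul] at this ⊢
      linear_combination this
  exact le_antisymm (aux hu hv) (aux hu.symm (dvd_sub_comm.1 (hu.symm.dvd.trans hv)))

lemma g5_squarefree : Squarefree g5 := by
  refine Separable.squarefree ⟨X, 1 + 2 * X ^ 2 + 2 * X ^ 4, ?_⟩
  have h : (5 : (ZMod 5)[X]) = 0 := CharP.cast_eq_zero _ 5
  simp only [g5, derivative_add, derivative_sub, derivative_X_pow, derivative_X, Nat.cast_ofNat,
    Nat.add_one_sub_one, map_ofNat]
  linear_combination (X ^ 6 + 2 * X ^ 8) * h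

lemma exists_bezout {u v w : (ZMod 5)[X]} (h : u * w = g5 - v ^ 2) :
    ∃ α β γ, α * u + β * w + γ * v = 1 := by
  set d₁ := EuclideanDomain.gcd u w with hd₁
  set d := EuclideanDomain.gcd d₁ v with hd
  have h1 : d ∣ u := (EuclideanDomain.gcd_dvd_left _ _).trans (EuclideanDomain.gcd_dvd_left _ _)
  have h2 : d ∣ w := (EuclideanDomain.gcd_dvd_left _ _).trans (EuclideanDomain.gcd_dvd_right _ _)
  have h3 : d ∣ v := EuclideanDomain.gcd_dvd_right _ _
  have h4 : d * d ∣ g5 := by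
    have : g5 = u * w + v * v := by rw [h]; ring
    rw [this]
    exact dvd_add (mul_dvd_mul h1 h2) (mul_dvd_mul h3 h3)
  obtain ⟨e, he⟩ := (g5_squarefree d h4).exists_right_inv
  have h5 := EuclideanDomain.gcd_eq_gcd_ab d₁ v
  have h6 := EuclideanDomain.gcd_eq_gcd_ab u w
  rw [← hd] at h5
  rw [← hd₁] at h6
  refine ⟨EuclideanDomain.gcdA u w * EuclideanDomain.gcdA d₁ v * e,
    EuclideanDomain.gcdB u w * EuclideanDomain.gcdA d₁ v * e,
    EuclideanDomain.gcdB d₁ v * e, ?_⟩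
  linear_combination he - e * h5 - e * EuclideanDomain.gcdA d₁ v * h6

lemma incl_five : (5 : R5) = 0 := by
  have h : (5 : (ZMod 5)[X]) = 0 := CharP.cast_eq_zero _ 5
  rw [← map_ofNat incl 5, h, map_zero]

lemma mumford_mul {u v w : (ZMod 5)[X]} (h : u * w ∣ g5 - v ^ 2)
    (hb : ∃ α β γ, α * u + β * w + γ * v = 1) :
    mumford u v * mumford w v = mumford (u * w) v := by
  obtain ⟨q, hq⟩ := h
  obtain ⟨α, β, γ, hb⟩ := hb
  have hq' := congrArg incl hq
  have hb' := congrArg incl hb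
  simp only [map_add, map_sub, map_mul, map_pow, map_one, ← y5_mul_self] at hq' hb'
  rw [mumford, mumford, mumford, Ideal.span_pair_mul_span_pair]
  apply le_antisymm
  · simp only [Ideal.span_le, Set.insert_subset_iff, Set.singleton_subset_iff, SetLike.mem_coe,
      Ideal.mem_span_pair, map_mul]
    refine ⟨⟨1, 0, by ring⟩, ⟨0, incl u, by ring⟩, ⟨0, incl w, by ring⟩,
      ⟨incl q, -2 * incl v, ?_⟩⟩
    linear_combination -hq'
  · set S : Set R5 := {incl u * incl w, incl u * (y5 - incl v), (y5 - incl v) * incl w,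
      (y5 - incl v) * (y5 - incl v)}
    have h1 : incl u * incl w ∈ Ideal.span S := Ideal.subset_span (Or.inl rfl)
    have h2 : incl u * (y5 - incl v) ∈ Ideal.span S := Ideal.subset_span (Or.inr (Or.inl rfl))
    have h3 : (y5 - incl v) * incl w ∈ Ideal.span S :=
      Ideal.subset_span (Or.inr (Or.inr (Or.inl rfl)))
    have h4 : (y5 - incl v) * (y5 - incl v) ∈ Ideal.span S :=
      Ideal.subset_span (Or.inr (Or.inr (Or.inr rfl)))
    rw [Ideal.span_le, Set.insert_subset_iff, Set.singleton_subset_iff]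
    refine ⟨by rw [map_mul]; exact h1, ?_⟩
    have h5 : y5 - incl v = incl α * (incl u * (y5 - incl v)) + incl β * ((y5 - incl v) * incl w)
        + 2 * incl γ * ((y5 - incl v) * (y5 - incl v))
        + (-2 * incl γ * incl q) * (incl u * incl w) := by
      linear_combination (-(y5 - incl v)) * hb' - 2 * incl γ * hq' +
        incl γ * incl v * (y5 - incl v) * incl_five
    rw [SetLike.mem_coe, h5]
    exact add_mem (add_mem (add_mem (Ideal.mul_mem_left _ _ h2) (Ideal.mul_mem_left _ _ h3))
      (Ideal.mul_mem_left _ _ h4)) (Ideal.mul_mem_left _ _ h1)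

lemma mumford_mul_neg {u v : (ZMod 5)[X]} (h : u ∣ g5 - v ^ 2) :
    mumford u v * mumford u (-v) = Ideal.span {incl u} := by
  obtain ⟨w, hw⟩ := h
  obtain ⟨α, β, γ, hb⟩ := exists_bezout hw.symm
  have hw' := congrArg incl hw
  have hb' := congrArg incl hb
  simp only [map_add, map_sub, map_mul, map_pow, map_one, ← y5_mul_self] at hw' hb'
  rw [mumford, mumford, Ideal.span_pair_mul_span_pair, map_neg]
  apply le_antisymm
  · simp only [Ideal.span_le, Set.insert_subset_iff, Set.singleton_subset_iff, SetLike.mem_coe,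
      Ideal.mem_span_singleton]
    refine ⟨dvd_mul_right _ _, dvd_mul_right _ _, dvd_mul_left _ _, ⟨incl w, ?_⟩⟩
    linear_combination hw'
  · set S : Set R5 := {incl u * incl u, incl u * (y5 - -incl v), (y5 - incl v) * incl u,
      (y5 - incl v) * (y5 - -incl v)}
    have h1 : incl u * incl u ∈ Ideal.span S := Ideal.subset_span (Or.inl rfl)
    have h2 : incl u * (y5 - -incl v) ∈ Ideal.span S := Ideal.subset_span (Or.inr (Or.inl rfl))
    have h3 : (y5 - incl v) * incl u ∈ Ideal.span S :=
      Ideal.subset_span (Or.inr (Or.inr (Or.inl rfl)))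
    have h4 : (y5 - incl v) * (y5 - -incl v) ∈ Ideal.span S :=
      Ideal.subset_span (Or.inr (Or.inr (Or.inr rfl)))
    rw [Ideal.span_singleton_le_iff_mem]
    have h5 : incl u = incl α * (incl u * incl u) + incl β * ((y5 - incl v) * (y5 - -incl v))
        + 3 * incl γ * (incl u * (y5 - -incl v)) + (-3 * incl γ) * ((y5 - incl v) * incl u) := by
      linear_combination (-incl u) * hb' - incl β * hw' - incl γ * incl u * incl v * incl_five
    rw [h5]
    exact add_mem (add_mem (add_mem (Ideal.mul_mem_left _ _ h1) (Ideal.mul_mem_left _ _ h4))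
      (Ideal.mul_mem_left _ _ h2)) (Ideal.mul_mem_left _ _ h3)

lemma g5_natDegree : g5.natDegree = 5 := by
  unfold g5
  compute_degree!

lemma g5_sub_sq_ne_zero (v : (ZMod 5)[X]) : g5 - v ^ 2 ≠ 0 := by
  intro h
  have := congrArg natDegree (sub_eq_zero.1 h)
  rw [g5_natDegree, natDegree_pow] at this
  omega

lemma mumford_ne_bot {u : (ZMod 5)[X]} (v : (ZMod 5)[X]) (hu : u ≠ 0) : mumford u v ≠ ⊥ := by
  intro h
  have h1 : incl u ∈ mumford u v := Ideal.subset_span (Or.inl rfl)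
  rw [h, Ideal.mem_bot] at h1
  exact hu (incl_injective (h1.trans (map_zero incl).symm))

/-- The ideal of all `y`-coordinates of the elements of an ideal of `R₅`. -/
def yCoord (I : Ideal R5) : Ideal (ZMod 5)[X] where
  carrier := {b | ∃ a, incl a + incl b * y5 ∈ I}
  zero_mem' := ⟨0, by simp⟩
  add_mem' := by
    rintro b b' ⟨a, h⟩ ⟨a', h'⟩
    refine ⟨a + a', ?_⟩
    convert add_mem h h' using 1
    simp only [map_add]
    ring
  smul_mem' := by
    rintro c b ⟨a, h⟩
    refine ⟨c * a, ?_⟩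
    convert I.mul_mem_left (incl c) h using 1
    simp only [smul_eq_mul, map_mul]
    ring

lemma exists_eq_span_mul_mumford {I : Ideal R5} (hI : I ≠ ⊥) :
    ∃ d u v, d ≠ 0 ∧ u ≠ 0 ∧ u ∣ g5 - v ^ 2 ∧ I = Ideal.span {incl d} * mumford u v := by
  obtain ⟨d, hd⟩ := IsPrincipalIdealRing.principal (yCoord I)
  have hb : ∀ {a b}, incl a + incl b * y5 ∈ I → d ∣ b := fun {a b} h => by
    have : b ∈ yCoord I := ⟨a, h⟩
    rwa [hd, Ideal.submodule_span_eq, Ideal.mem_span_singleton] at this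
  have ha : ∀ {a b}, incl a + incl b * y5 ∈ I → d ∣ a := fun {a b} h => by
    refine hb (a := b * g5) ?_
    convert I.mul_mem_left y5 h using 1
    rw [map_mul, ← y5_mul_self]
    ring
  have hd0 : d ≠ 0 := by
    rintro rfl
    refine hI ((Submodule.eq_bot_iff _).2 fun z hz => ?_)
    obtain ⟨a, b, rfl⟩ := exists_eq_incl_add z
    rw [zero_dvd_iff.1 (ha hz), zero_dvd_iff.1 (hb hz)]
    simp
  obtain ⟨a₀, h₀⟩ : d ∈ yCoord I := by
    rw [hd]
    exact Submodule.mem_span_singleton_self d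
  obtain ⟨v, rfl⟩ : ∃ v, a₀ = -(d * v) := by
    obtain ⟨v, hv⟩ := ha h₀
    exact ⟨-v, by rw [hv]; ring⟩
  have h₁ : incl d * (y5 - incl v) ∈ I := by
    convert h₀ using 1
    rw [map_neg, map_mul]
    ring
  obtain ⟨u, hu⟩ := IsPrincipalIdealRing.principal
    (Submodule.comap (LinearMap.mulLeft (ZMod 5)[X] d) (Ideal.comap incl I))
  have hu' : ∀ a, incl (d * a) ∈ I ↔ u ∣ a := fun a => by
    rw [← Ideal.mem_span_singleton, ← Ideal.submodule_span_eq, ← hu]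
    rfl
  have hN : u ∣ g5 - v ^ 2 := by
    rw [← hu']
    convert I.mul_mem_left (y5 + incl v) h₁ using 1
    simp only [map_mul, map_sub, map_pow, ← y5_mul_self]
    ring
  refine ⟨d, u, v, hd0, ?_, hN, le_antisymm ?_ ?_⟩
  · rintro rfl
    exact g5_sub_sq_ne_zero v (zero_dvd_iff.1 hN)
  · intro z hz
    obtain ⟨a, b, rfl⟩ := exists_eq_incl_add z
    obtain ⟨a, rfl⟩ := ha hz
    obtain ⟨b, rfl⟩ := hb hz
    refine Ideal.mem_span_singleton_mul.2 ⟨incl a + incl b * y5, ?_, by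
      simp only [map_mul]; ring⟩
    rw [mem_mumford hN, ← hu']
    convert sub_mem hz (I.mul_mem_left (incl b) h₁) using 1
    simp only [map_mul, map_add]
    ring
  · rw [mumford, Ideal.span_mul_span', Set.singleton_mul, Set.image_pair, Ideal.span_le,
      Set.insert_subset_iff, Set.singleton_subset_iff]
    exact ⟨by rw [SetLike.mem_coe, ← map_mul, hu'], h₁⟩

lemma dvd_of_span_mul_mumford_eq {p q u v u' v' : (ZMod 5)[X]}
    (h : Ideal.span {incl p} * mumford u v = Ideal.span {incl q} * mumford u' v') : q ∣ p := by
  have h1 : y5 - incl v ∈ mumford u v := Ideal.subset_span (Or.inr rfl)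
  have h2 := Ideal.mul_mem_mul (Ideal.mem_span_singleton_self (incl p)) h1
  rw [h, Ideal.mem_span_singleton_mul] at h2
  obtain ⟨x, -, hx⟩ := h2
  obtain ⟨c, d, rfl⟩ := exists_eq_incl_add x
  have h3 : incl (q * c) + incl (q * d) * y5 = incl (-(p * v)) + incl p * y5 := by
    simp only [map_mul, map_neg]
    linear_combination hx
  exact ⟨d, (incl_add_inj h3).2.symm⟩

lemma exists_eq_incl_of_mul_eq {e t : R5} {p : (ZMod 5)[X]} (hp : p ≠ 0)
    (hdeg : p.natDegree ≤ 4) (h : e * t = incl p) : ∃ a, e = incl a := by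
  obtain ⟨a, b, rfl⟩ := exists_eq_incl_add e
  obtain ⟨c, d, rfl⟩ := exists_eq_incl_add t
  have h1 : incl (a * c + g5 * b * d) + incl (a * d + b * c) * y5 = incl p + incl 0 * y5 := by
    rw [map_zero, zero_mul, add_zero, ← h]
    simp only [map_add, map_mul, ← y5_mul_self]
    ring
  obtain ⟨h2, h3⟩ := incl_add_inj h1
  have h4 : (a ^ 2 - g5 * b ^ 2) * (c ^ 2 - g5 * d ^ 2) = p ^ 2 := by
    rw [← h2]
    linear_combination (-g5 * (a * d + b * c)) * h3
  have hN : ∀ a b : (ZMod 5)[X], b ≠ 0 → 5 ≤ (a ^ 2 - g5 * b ^ 2).natDegree := by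
    intro a b hb
    have hg : g5 ≠ 0 := by simpa using g5_sub_sq_ne_zero 0
    have h5 : (g5 * b ^ 2).natDegree = 5 + 2 * b.natDegree := by
      rw [natDegree_mul hg (pow_ne_zero _ hb), g5_natDegree, natDegree_pow]
    have h6 : (a ^ 2).natDegree = 2 * a.natDegree := natDegree_pow _ _
    rcases lt_or_gt_of_ne (show (a ^ 2).natDegree ≠ (g5 * b ^ 2).natDegree by omega) with h | h
    · rw [natDegree_sub_eq_right_of_natDegree_lt h]
      omega
    · rw [natDegree_sub_eq_left_of_natDegree_lt h]
      omega
  by_cases hb : b = 0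
  · exact ⟨a, by simp [hb]⟩
  exfalso
  by_cases hd : d = 0
  · subst hd
    have hc : c ≠ 0 := by
      rintro rfl
      apply hp
      rw [← h2]
      ring
    rw [mul_zero, zero_add] at h3
    exact mul_ne_zero hb hc h3
  · have h5 := congrArg natDegree h4
    have h6 : p ^ 2 ≠ 0 := pow_ne_zero _ hp
    rw [← h4] at h6
    rw [natDegree_mul (left_ne_zero_of_mul h6) (right_ne_zero_of_mul h6), natDegree_pow] at h5
    have := hN a b hb
    have := hN c d hd
    omega

section ClassGroup

variable [IsDedekindDomain R5]

/-- The class of the ideal `(u, y − v)`. -/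
def mumfordClass (u v : (ZMod 5)[X]) (hu : u ≠ 0) : ClassGroup R5 :=
  ClassGroup.mk0 ⟨mumford u v, mem_nonZeroDivisors_of_ne_zero (mumford_ne_bot v hu)⟩

lemma mumfordClass_eq_mk0 {u v : (ZMod 5)[X]} (hu : u ≠ 0) {I : Ideal R5} (hI : I ∈ (Ideal R5)⁰)
    (h : mumford u v = I) : mumfordClass u v hu = ClassGroup.mk0 ⟨I, hI⟩ := by
  subst h
  rfl

lemma mumfordClass_congr {u v u' v' : (ZMod 5)[X]} (hu : u ≠ 0) (hu' : u' ≠ 0)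
    (h : Associated u u') (hv : u ∣ v - v') : mumfordClass u v hu = mumfordClass u' v' hu' :=
  mumfordClass_eq_mk0 hu _ (mumford_congr h hv)

lemma mumfordClass_neg {u v : (ZMod 5)[X]} (hu : u ≠ 0) (h : u ∣ g5 - v ^ 2) :
    mumfordClass u (-v) hu = (mumfordClass u v hu)⁻¹ := by
  rw [eq_comm, inv_eq_iff_eq_inv]
  exact ClassGroup.mk0_eq_mk0_inv_iff.2
    ⟨incl u, fun h0 => hu (incl_injective (h0.trans (map_zero incl).symm)), mumford_mul_neg h⟩

lemma mumfordClass_mul {u v w : (ZMod 5)[X]} (hu : u ≠ 0) (hw : w ≠ 0) (h : u * w ∣ g5 - v ^ 2)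
    (hb : ∃ α β γ, α * u + β * w + γ * v = 1) :
    mumfordClass u v hu * mumfordClass w v hw = mumfordClass (u * w) v (mul_ne_zero hu hw) := by
  rw [mumfordClass, mumfordClass, ← map_mul]
  exact congrArg ClassGroup.mk0 (Subtype.ext (mumford_mul h hb))

lemma mumfordClass_mul_cofactor {u v w : (ZMod 5)[X]} (hu : u ≠ 0) (hw : w ≠ 0)
    (h : u * w = g5 - v ^ 2) : mumfordClass u v hu * mumfordClass w v hw = 1 := by
  rw [mumfordClass_mul hu hw h.dvd (exists_bezout h)]
  refine (ClassGroup.mk0_eq_one_iff _).2 ⟨y5 - incl v, ?_⟩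
  rw [mumford, h, Ideal.span_insert, sup_eq_right, Ideal.span_singleton_le_iff_mem]
  refine Ideal.mem_span_singleton.2 ⟨y5 + incl v, ?_⟩
  simp only [map_sub, map_pow, ← y5_mul_self]
  ring

lemma mumfordClass_eq_reduced {u v : (ZMod 5)[X]} (hu : u ≠ 0) (h : u ∣ g5 - v ^ 2) :
    ∃ u' v', ∃ hu' : u'.Monic, u'.natDegree ≤ 2 ∧ v'.degree < u'.degree ∧ u' ∣ g5 - v' ^ 2 ∧
      mumfordClass u v hu = mumfordClass u' v' hu'.ne_zero := by
  induction hn : u.natDegree using Nat.strong_induction_on generalizing u v with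
  | _ n ih =>
  have hv : u ∣ v - v % u :=
    ⟨v / u, by linear_combination -EuclideanDomain.div_add_mod v u⟩
  have hdeg : (v % u).degree < u.degree := EuclideanDomain.mod_lt v hu
  have h1 : u ∣ g5 - (v % u) ^ 2 := by
    have : g5 - (v % u) ^ 2 = g5 - v ^ 2 + (v - v % u) * (v + v % u) := by ring
    rw [this]
    exact dvd_add h (hv.mul_right _)
  by_cases hn2 : n ≤ 2
  · refine ⟨normalize u, v % u, monic_normalize hu, ?_, ?_, ?_, ?_⟩
    · rwa [natDegree_eq_of_degree_eq degree_normalize, hn]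
    · rwa [degree_normalize]
    · exact (normalize_associated u).dvd.trans h1
    · exact mumfordClass_congr hu _ (associated_normalize u) hv
  · obtain ⟨w, hw⟩ := h1
    have hw0 : w ≠ 0 := by
      rintro rfl
      exact g5_sub_sq_ne_zero _ (hw.trans (mul_zero u))
    have h2 : (v % u).natDegree < n := by
      rw [← hn]
      exact natDegree_mod_lt v (by omega)
    have h3 : u.natDegree + w.natDegree ≤ max 5 (2 * (v % u).natDegree) := by
      rw [← natDegree_mul hu hw0, ← hw]
      refine (natDegree_sub_le _ _).trans ?_
      rw [g5_natDegree, natDegree_pow]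
    have h4 : w ∣ g5 - (v % u) ^ 2 := ⟨u, by rw [hw, mul_comm]⟩
    obtain ⟨u', v', hu', hd, hv', hdvd, heq⟩ := ih w.natDegree (by omega) (v := -(v % u)) hw0
      (by rwa [neg_sq]) rfl
    refine ⟨u', v', hu', hd, hv', hdvd, ?_⟩
    rw [← heq, mumfordClass_neg hw0 h4, ← mul_eq_one_iff_eq_inv,
      mumfordClass_congr hu hu (Associated.refl u) hv]
    exact mumfordClass_mul_cofactor hu hw0 hw.symm

lemma exists_mumfordClass_eq (c : ClassGroup R5) :
    ∃ u v, ∃ hu : u.Monic, u.natDegree ≤ 2 ∧ v.degree < u.degree ∧ u ∣ g5 - v ^ 2 ∧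
      mumfordClass u v hu.ne_zero = c := by
  obtain ⟨⟨I, hI⟩, rfl⟩ := ClassGroup.mk0_surjective c
  obtain ⟨d, u, v, hd, hu, h, rfl⟩ := exists_eq_span_mul_mumford (nonZeroDivisors.ne_zero hI)
  obtain ⟨u', v', hu', h1, h2, h3, h4⟩ := mumfordClass_eq_reduced hu h
  refine ⟨u', v', hu', h1, h2, h3, h4.symm.trans (ClassGroup.mk0_eq_mk0_iff.2
    ⟨incl d, 1, fun h0 => hd (incl_injective (h0.trans (map_zero incl).symm)), one_ne_zero, ?_⟩)⟩
  rw [Ideal.span_singleton_one, Ideal.one_eq_top.symm, one_mul]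

lemma mumfordClass_inj {u v u' v' : (ZMod 5)[X]} (hu : u.Monic) (hu' : u'.Monic)
    (hd : u.natDegree ≤ 2) (hd' : u'.natDegree ≤ 2) (hv : v.degree < u.degree)
    (hv' : v'.degree < u'.degree) (h : u ∣ g5 - v ^ 2) (h' : u' ∣ g5 - v' ^ 2)
    (heq : mumfordClass u v hu.ne_zero = mumfordClass u' v' hu'.ne_zero) : u = u' ∧ v = v' := by
  have h1 : mumfordClass u v hu.ne_zero = (mumfordClass u' (-v') hu'.ne_zero)⁻¹ := by
    rw [mumfordClass_neg _ h', inv_inv, heq]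
  have h2 : mumfordClass u (-v) hu.ne_zero = (mumfordClass u' v' hu'.ne_zero)⁻¹ := by
    rw [mumfordClass_neg _ h, heq]
  obtain ⟨e, -, he⟩ := ClassGroup.mk0_eq_mk0_inv_iff.1 h1
  obtain ⟨t, -, ht⟩ := ClassGroup.mk0_eq_mk0_inv_iff.1 h2
  simp only at he ht
  have h3 : Ideal.span {e} * Ideal.span {t} = Ideal.span {incl (u * u')} := by
    rw [map_mul, ← Ideal.span_singleton_mul_span_singleton, ← mumford_mul_neg h,
      ← mumford_mul_neg h', ← he, ← ht]
    ring
  rw [Ideal.span_singleton_mul_span_singleton, Ideal.span_singleton_eq_span_singleton] at h3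
  obtain ⟨s, hs⟩ := h3
  obtain ⟨a, rfl⟩ := exists_eq_incl_of_mul_eq (mul_ne_zero hu.ne_zero hu'.ne_zero)
    (by rw [hu.natDegree_mul hu']; omega) ((mul_assoc e t s).symm.trans hs)
  have h4 : mumford u v * Ideal.span {incl u'} = Ideal.span {incl a} * mumford u' v' := by
    rw [← he, ← mumford_mul_neg h']
    ring
  have h5 : a ∣ u' ∧ u' ∣ a := by
    rw [mul_comm] at h4
    exact ⟨dvd_of_span_mul_mumford_eq h4, dvd_of_span_mul_mumford_eq h4.symm⟩
  have h6 : Associated (incl a) (incl u') := (associated_of_dvd_dvd h5.1 h5.2).map incl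
  rw [Ideal.span_singleton_eq_span_singleton.2 h6, mul_comm] at h4
  have h7 : mumford u v = mumford u' v' := by
    refine mul_left_cancel₀ (fun h0 => hu'.ne_zero (incl_injective ?_)) h4
    rw [map_zero]
    exact Ideal.span_singleton_eq_bot.1 h0
  have h8 : u' ∣ u := (incl_mem_mumford h' u).1 (h7 ▸ Ideal.subset_span (Or.inl rfl))
  have h9 : u ∣ u' := (incl_mem_mumford h u').1 (h7.symm ▸ Ideal.subset_span (Or.inl rfl))
  obtain rfl := eq_of_monic_of_associated hu hu' (associated_of_dvd_dvd h9 h8)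
  refine ⟨rfl, sub_eq_zero.1 (eq_zero_of_dvd_of_degree_lt ?_
    ((degree_sub_le v v').trans_lt (max_lt hv hv')))⟩
  rw [← incl_mem_mumford h]
  have h10 : y5 - incl v' ∈ mumford u v := h7.symm ▸ Ideal.subset_span (Or.inr rfl)
  have h11 : y5 - incl v ∈ mumford u v := Ideal.subset_span (Or.inr rfl)
  convert sub_mem h10 h11 using 1
  rw [map_sub]
  ring

end ClassGroup

/-- Coefficients of a pair `(u, v)` with `u` monic of degree at most `2` and `deg v < deg u`. -/
abbrev MumfordCoeff : Type :=
  Unit ⊕ (ZMod 5 × ZMod 5) ⊕ (ZMod 5 × ZMod 5 × ZMod 5 × ZMod 5)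

namespace MumfordCoeff

/-- The monic polynomial `u` with the given coefficients. -/
def u : MumfordCoeff → (ZMod 5)[X]
  | .inl _ => 1
  | .inr (.inl (a, _)) => X + C a
  | .inr (.inr (a, b, _, _)) => X ^ 2 + C a * X + C b

/-- The polynomial `v` with the given coefficients. -/
def v : MumfordCoeff → (ZMod 5)[X]
  | .inl _ => 0
  | .inr (.inl (_, b)) => C b
  | .inr (.inr (_, _, c, d)) => C c * X + C d

/-- The coefficients of the remainder of `X⁵ − X³ + X − v²` modulo `u`. -/
def rem : MumfordCoeff → ZMod 5 × ZMod 5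
  | .inl _ => (0, 0)
  | .inr (.inl (a, b)) => (0, -a ^ 5 + a ^ 3 - a - b ^ 2)
  | .inr (.inr (a, b, c, d)) =>
    (a ^ 4 - 3 * a ^ 2 * b + b ^ 2 - (a ^ 2 - b) + 1 + c ^ 2 * a - 2 * c * d,
      -b * (-a ^ 3 + 2 * a * b) - a * b + c ^ 2 * b - d ^ 2)

lemma monic_quadratic (a b : ZMod 5) : (X ^ 2 + C a * X + C b : (ZMod 5)[X]).Monic := by
  monicity!

lemma natDegree_quadratic_eq (a b : ZMod 5) :
    (X ^ 2 + C a * X + C b : (ZMod 5)[X]).natDegree = 2 := by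
  compute_degree!

lemma degree_linear_lt_quadratic (a b c d : ZMod 5) :
    (C c * X + C d : (ZMod 5)[X]).degree < (X ^ 2 + C a * X + C b : (ZMod 5)[X]).degree := by
  rw [degree_eq_natDegree (monic_quadratic a b).ne_zero, natDegree_quadratic_eq]
  exact degree_linear_lt

lemma u_monic (t : MumfordCoeff) : t.u.Monic := by
  rcases t with _ | ⟨a, _⟩ | ⟨a, b, _, _⟩
  · exact monic_one
  · exact monic_X_add_C a
  · exact monic_quadratic a b

lemma natDegree_u_le (t : MumfordCoeff) : t.u.natDegree ≤ 2 := by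
  rcases t with _ | ⟨a, _⟩ | ⟨a, b, _, _⟩ 
  · exact natDegree_one.trans_le zero_le_two
  · exact (natDegree_X_add_C a).trans_le one_le_two
  · exact (natDegree_quadratic_eq a b).le

lemma degree_v_lt (t : MumfordCoeff) : t.v.degree < t.u.degree := by
  rcases t with _ | ⟨a, b⟩ | ⟨a, b, c, d⟩
  · simp [u, v]
  · simpa [u, v] using degree_C_lt
  · exact degree_linear_lt_quadratic a b c d

lemma exists_sub_sq_eq (t : MumfordCoeff) :
    ∃ q, g5 - t.v ^ 2 = t.u * q + (C t.rem.1 * X + C t.rem.2) := by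
  rcases t with _ | ⟨a, b⟩ | ⟨a, b, c, d⟩
  · exact ⟨g5, by simp [u, v, rem]⟩
  · refine ⟨X ^ 4 - C a * X ^ 3 + (C a ^ 2 - 1) * X ^ 2 + (C a - C a ^ 3) * X
      + (C a ^ 4 - C a ^ 2 + 1), ?_⟩
    simp only [u, v, rem, g5, map_add, map_sub, map_pow, map_neg, map_zero]
    ring
  · refine ⟨X ^ 3 - C a * X ^ 2 + (C a ^ 2 - C b - 1) * X + (-C a ^ 3 + 2 * C a * C b + C a)
      - C c ^ 2, ?_⟩
    simp only [u, v, rem, g5, map_add, map_sub, map_mul, map_pow, map_neg, map_one, map_ofNat]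
    ring

lemma dvd_iff (t : MumfordCoeff) : t.u ∣ g5 - t.v ^ 2 ↔ t.rem = 0 := by
  obtain ⟨q, hq⟩ := t.exists_sub_sq_eq
  rw [hq, dvd_add_right (dvd_mul_right _ _)]
  constructor
  · intro h
    have h0 : C t.rem.1 * X + C t.rem.2 = 0 := by
      refine eq_zero_of_dvd_of_degree_lt h ?_
      rcases t with _ | ⟨a, b⟩ | ⟨a, b, c, d⟩
      · simp [u, rem]
      · simp only [u, rem, C_0, zero_mul, zero_add, degree_X_add_C]
        exact degree_C_lt
      · exact degree_linear_lt_quadratic a b _ _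
    refine Prod.ext ?_ ?_
    · simpa using congrArg (coeff · 1) h0
    · simpa using congrArg (coeff · 0) h0
  · intro h
    simp [h]

lemma exists_eq {p q : (ZMod 5)[X]} (hp : p.Monic) (hd : p.natDegree ≤ 2)
    (hq : q.degree < p.degree) : ∃ t : MumfordCoeff, t.u = p ∧ t.v = q := by
  rw [degree_eq_natDegree hp.ne_zero] at hq
  have hlead := hp.coeff_natDegree
  interval_cases h : p.natDegree
  · refine ⟨.inl (), (hp.natDegree_eq_zero.1 h).symm, ?_⟩
    have : q = 0 := by simpa using hq
    exact this.symm
  · refine ⟨.inr (.inl (p.coeff 0, q.coeff 0)), ?_, ?_⟩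
    · exact (hp.eq_X_add_C h).symm
    · exact (eq_C_of_degree_le_zero (Order.lt_succ_iff.1 hq)).symm
  · refine ⟨.inr (.inr (p.coeff 1, p.coeff 0, q.coeff 1, q.coeff 0)), ?_, ?_⟩
    · have := eq_quadratic_of_degree_le_two (natDegree_le_iff_degree_le.1 h.le)
      rw [hlead, C_1, one_mul] at this
      exact this.symm
    · exact (eq_X_add_C_of_degree_le_one (Order.lt_succ_iff.1 hq)).symm

lemma eq_of_u_eq_of_v_eq {s t : MumfordCoeff} (hu : s.u = t.u) (hv : s.v = t.v) : s = t := by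
  have hdeg := congrArg natDegree hu
  have h0 := congrArg (coeff · 0) hu
  have h1 := congrArg (coeff · 1) hu
  have h2 := congrArg (coeff · 0) hv
  have h3 := congrArg (coeff · 1) hv
  rcases s with _ | ⟨a, b⟩ | ⟨a, b, c, d⟩ <;> rcases t with _ | ⟨a', b'⟩ | ⟨a', b', c', d'⟩ <;>
    simp only [u, natDegree_one, natDegree_X_add_C, natDegree_quadratic_eq, zero_ne_one,
      one_ne_zero, OfNat.ofNat_ne_zero, OfNat.zero_ne_ofNat, OfNat.one_ne_ofNat,
      OfNat.ofNat_ne_one] at hdeg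
  · rfl
  · simp [u, v] at h0 h2
    rw [h0, h2]
  · simp [u, v, coeff_X, coeff_C] at h0 h1 h2 h3
    rw [h0, h1, h2, h3]

lemma card_rem_eq_zero : Fintype.card {t : MumfordCoeff // t.rem = 0} = 64 := by
  decide +kernel

end MumfordCoeff

lemma X_add_one_ne_zero : (X + 1 : (ZMod 5)[X]) ≠ 0 := (monic_X_add_C (1 : ZMod 5)).ne_zero

/-- The norm of `y − (x² − x)`, whose divisor is `P₀ + 4 P_{4,2} − 5 P_∞`. -/
lemma X_mul_X_add_one_pow_eq :
    (X * (X + 1) ^ 4 : (ZMod 5)[X]) = g5 - (X ^ 2 - X) ^ 2 := by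
  have h : (5 : (ZMod 5)[X]) = 0 := CharP.cast_eq_zero _ 5
  unfold g5
  linear_combination (X ^ 4 + X ^ 3 + X ^ 2) * h

lemma X_add_one_dvd : (X + 1 : (ZMod 5)[X]) ∣ g5 - 2 ^ 2 := by
  have h : (5 : (ZMod 5)[X]) = 0 := CharP.cast_eq_zero _ 5
  refine ⟨X ^ 4 - X ^ 3 + 1, ?_⟩
  unfold g5
  linear_combination -h

lemma X_dvd_g5 : X ∣ g5 - 0 ^ 2 := ⟨X ^ 4 - X ^ 2 + 1, by unfold g5; ring⟩

lemma incl_X_add_one : incl (X + 1) = x5 - 4 := by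
  rw [map_add, map_one, incl_X]
  linear_combination incl_five

section ClassGroup

variable [IsDedekindDomain R5]

lemma card_classGroup : Nat.card (ClassGroup R5) = 64 := by
  rw [← MumfordCoeff.card_rem_eq_zero, ← Nat.card_eq_fintype_card]
  refine (Nat.card_congr (Equiv.ofBijective
    (fun t : {t : MumfordCoeff // t.rem = 0} => mumfordClass t.1.u t.1.v t.1.u_monic.ne_zero)
    ⟨?_, ?_⟩)).symm
  · intro s t h
    obtain ⟨hu, hv⟩ := mumfordClass_inj s.1.u_monic t.1.u_monic s.1.natDegree_u_le
      t.1.natDegree_u_le s.1.degree_v_lt t.1.degree_v_lt (s.1.dvd_iff.2 s.2) (t.1.dvd_iff.2 t.2) h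
    exact Subtype.ext (MumfordCoeff.eq_of_u_eq_of_v_eq hu hv)
  · intro c
    obtain ⟨u, v, hu, hd, hv, h, rfl⟩ := exists_mumfordClass_eq c
    obtain ⟨t, rfl, rfl⟩ := MumfordCoeff.exists_eq hu hd hv
    exact ⟨⟨t, t.dvd_iff.1 h⟩, rfl⟩

lemma mumfordClass_X_ne_one : mumfordClass X 0 X_ne_zero ≠ 1 := by
  intro h
  have h1 : mumfordClass 1 0 one_ne_zero = 1 := by
    refine (ClassGroup.mk0_eq_one_iff _).2 ⟨1, ?_⟩
    have : mumford 1 0 = ⊤ :=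
      (Ideal.eq_top_iff_one _).2 (Ideal.subset_span (Or.inl (map_one incl).symm))
    rw [this]
    exact Ideal.span_singleton_one.symm
  have := mumfordClass_inj monic_X monic_one (by simp) (by simp) (by simp) (by simp)
    (v := 0) (v' := 0) X_dvd_g5 (one_dvd _) (h.trans h1.symm)
  simpa using congrArg natDegree this.1

lemma mumfordClass_X_sq : mumfordClass X 0 X_ne_zero ^ 2 = 1 := by
  have h := mumfordClass_neg X_ne_zero X_dvd_g5
  rw [pow_two, mul_eq_one_iff_eq_inv, ← h, mumfordClass_congr X_ne_zero X_ne_zero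
    (Associated.refl _) (v := 0) (v' := -0) (by simp)]

lemma mumfordClass_X_add_one_pow : mumfordClass (X + 1) 2 X_add_one_ne_zero ^ 4 =
    (mumfordClass X 0 X_ne_zero)⁻¹ := by
  set v : (ZMod 5)[X] := X ^ 2 - X with hv
  have hdvd : X * (X + 1) ^ 4 = g5 - v ^ 2 := X_mul_X_add_one_pow_eq
  have hcop : IsCoprime (X + 1) v := ⟨6 - 3 * X, 3, by
    have h : (5 : (ZMod 5)[X]) = 0 := CharP.cast_eq_zero _ 5
    rw [hv]
    linear_combination h⟩
  have hb : ∀ k, ∃ α β γ, α * (X + 1) ^ k + β * (X + 1) ^ k + γ * v = 1 := fun k => by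
    obtain ⟨α, γ, h⟩ := hcop.pow_left (m := k)
    exact ⟨α, 0, γ, by rw [zero_mul, add_zero, h]⟩
  have h0 := X_add_one_ne_zero
  have h1 : mumfordClass (X + 1) 2 h0 = mumfordClass (X + 1) v h0 :=
    mumfordClass_congr _ _ (Associated.refl _) ⟨2 - X, by rw [hv]; ring⟩
  have h2 : mumfordClass (X + 1) v h0 ^ 2 = mumfordClass ((X + 1) ^ 2) v (pow_ne_zero 2 h0) := by
    rw [pow_two, mumfordClass_mul h0 h0 ⟨X * (X + 1) ^ 2, by rw [← hdvd]; ring⟩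
      (by simpa using hb 1)]
    exact mumfordClass_congr _ _ (by rw [pow_two]) (by simp)
  have h3 : mumfordClass (X + 1) v h0 ^ 4 = mumfordClass ((X + 1) ^ 4) v (pow_ne_zero 4 h0) := by
    rw [show 4 = 2 * 2 from rfl, pow_mul, h2, pow_two, mumfordClass_mul _ _
      ⟨X, by rw [← hdvd]; ring⟩ (hb 2)]
    exact mumfordClass_congr _ _ (by rw [← pow_add]) (by simp)
  have h4 : mumfordClass X 0 X_ne_zero = mumfordClass X v X_ne_zero :=
    mumfordClass_congr _ _ (Associated.refl _) ⟨1 - X, by rw [hv]; ring⟩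
  rw [h1, h3, h4, ← mul_eq_one_iff_eq_inv, mul_comm]
  exact mumfordClass_mul_cofactor _ _ hdvd

lemma orderOf_mumfordClass_X_add_one :
    orderOf (mumfordClass (X + 1) 2 X_add_one_ne_zero) = 8 := by
  refine orderOf_eq_prime_pow (p := 2) (n := 2) ?_ ?_
  · rw [show 2 ^ 2 = 4 from rfl, mumfordClass_X_add_one_pow, inv_eq_one]
    exact mumfordClass_X_ne_one
  · rw [show 2 ^ (2 + 1) = 4 * 2 from rfl, pow_mul, mumfordClass_X_add_one_pow, inv_pow,
      mumfordClass_X_sq, inv_one]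

end ClassGroup


/-- The subgroup of the class group of `R₅` generated by the classes of the maximal ideals
`(x, y)`, `(x − 4, y − 3)` and `(x − 4, y − 2)` has index 8.  (The hypotheses
`IsDedekindDomain R5` and `h₀, h₁, h₂` are true facts, supplied so that the classes make
sense.) -/
theorem stmt_12 [IsDedekindDomain R5]
    (h₀ : Ideal.span {x5, y5} ∈ (Ideal R5)⁰)
    (h₁ : Ideal.span {x5 - 4, y5 - 3} ∈ (Ideal R5)⁰)
    (h₂ : Ideal.span {x5 - 4, y5 - 2} ∈ (Ideal R5)⁰) :
    (Subgroup.closure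
      {ClassGroup.mk0 (⟨Ideal.span {x5, y5}, h₀⟩ : (Ideal R5)⁰),
       ClassGroup.mk0 (⟨Ideal.span {x5 - 4, y5 - 3}, h₁⟩ : (Ideal R5)⁰),
       ClassGroup.mk0 (⟨Ideal.span {x5 - 4, y5 - 2}, h₂⟩ : (Ideal R5)⁰)}).index = 8 := by
  set p₀ := mumfordClass X 0 X_ne_zero with hp₀
  set p := mumfordClass (X + 1) 2 X_add_one_ne_zero with hp
  have e₀ : ClassGroup.mk0 (⟨Ideal.span {x5, y5}, h₀⟩ : (Ideal R5)⁰) = p₀ :=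
    (mumfordClass_eq_mk0 _ h₀ (by rw [mumford, incl_X, map_zero, sub_zero])).symm
  have e₂ : ClassGroup.mk0 (⟨Ideal.span {x5 - 4, y5 - 2}, h₂⟩ : (Ideal R5)⁰) = p :=
    (mumfordClass_eq_mk0 _ h₂ (by rw [mumford, incl_X_add_one, map_ofNat])).symm
  have e₁ : ClassGroup.mk0 (⟨Ideal.span {x5 - 4, y5 - 3}, h₁⟩ : (Ideal R5)⁰) = p⁻¹ := by
    rw [hp, ← mumfordClass_neg X_add_one_ne_zero X_add_one_dvd]
    refine (mumfordClass_eq_mk0 _ h₁ ?_).symm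
    rw [mumford, incl_X_add_one, map_neg, map_ofNat,
      show -(2 : R5) = 3 by linear_combination -incl_five]
  have hp₀' : p₀ = p ^ (-4 : ℤ) := by
    rw [zpow_neg, zpow_ofNat, hp, mumfordClass_X_add_one_pow, inv_inv]
  have hH : Subgroup.closure {p₀, p⁻¹, p} = Subgroup.zpowers p := by
    apply le_antisymm
    · rw [Subgroup.closure_le]
      rintro _ (rfl | rfl | rfl)
      · exact hp₀' ▸ zpow_mem (Subgroup.mem_zpowers p) _
      · exact inv_mem (Subgroup.mem_zpowers p)
      · exact Subgroup.mem_zpowers p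
    · exact Subgroup.zpowers_le.2 (Subgroup.subset_closure (Or.inr (Or.inr rfl)))
  rw [e₀, e₁, e₂, hH]
  have hcard := (Subgroup.zpowers p).card_mul_index
  rw [Nat.card_zpowers, orderOf_mumfordClass_X_add_one, card_classGroup] at hcard
  omega
end
end
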